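/- With f₀, h, Ω as in the context: let x* = (w*, y*) ∈ ℝ×T³ with w* ≥ w₃, and set R* := 3/(4·w*^{1/3}). Then mes₄( B_{R*}(x*) ∩ Ω ) < 32·√h · mes₄(B_{R*}), where B_{R*}(x*) is the metric ball of radius R* centered at x* in ℝ×T³ and mes₄(B_{R*}) = π²R*⁴/2 is the volume of a four-dimensional ball of radius R*. -/

import Mathlib

open Real MeasureTheory

noncomputable section

/-- `w_k = (27/8)·k^{3/2}`. -/
def wseq (k : ℕ) : ℝ := (27 / 8) * (k : ℝ) ^ ((3 : ℝ) / 2)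

/-- The properties of the fixed cutoff function `ζ`: smooth, `ζ = 0` on `(-∞,0]`,
`ζ = 1` on `[1,∞)`, `0 ≤ ζ ≤ 1`, `ζ' > 0` on `(0,1)`, and `ζ(t) + ζ(1-t) = 1`. -/
def IsCutoff (ζ : ℝ → ℝ) : Prop :=
  ContDiff ℝ (⊤ : ℕ∞) ζ ∧ (∀ t : ℝ, t ≤ 0 → ζ t = 0) ∧ (∀ t : ℝ, 1 ≤ t → ζ t = 1) ∧
    (∀ t : ℝ, ζ t ∈ Set.Icc (0 : ℝ) 1) ∧ (∀ t ∈ Set.Ioo (0 : ℝ) 1, 0 < deriv ζ t) ∧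
    (∀ t : ℝ, ζ t + ζ (1 - t) = 1)

/-- The properties of the fixed sequence `(a_k)` in `ℤ³`:
`|a_k|² = 4k+1` and `|a_k · a_{k+1}| ≤ |a_k||a_{k+1}|/√3` for all `k ≥ 1`. -/
def IsGoodSeq (a : ℕ → Fin 3 → ℤ) : Prop :=
  ∀ k : ℕ, 1 ≤ k →
    ((∑ i : Fin 3, (a k i) ^ 2 = 4 * (k : ℤ) + 1) ∧
      |∑ i : Fin 3, ((a k i : ℝ) * (a (k + 1) i : ℝ))| ≤
        Real.sqrt (∑ i : Fin 3, (a k i : ℝ) ^ 2) *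
          Real.sqrt (∑ i : Fin 3, (a (k + 1) i : ℝ) ^ 2) / Real.sqrt 3)

/-- The function `f₀(w,y) = Σ_{k≥2} ζ((w-w_{k-1})/(w_k-w_{k-1}))·ζ((w_{k+1}-w)/(w_{k+1}-w_k))·cos(a_k·y)`
(a locally finite sum), `2π`-periodic in each coordinate of `y`. -/
def f0 (ζ : ℝ → ℝ) (a : ℕ → Fin 3 → ℤ) (w : ℝ) (y : Fin 3 → ℝ) : ℝ :=
  ∑' k : ℕ, if 2 ≤ k then
      ζ ((w - wseq (k - 1)) / (wseq k - wseq (k - 1))) *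
        ζ ((wseq (k + 1) - w) / (wseq (k + 1) - wseq k)) *
        Real.cos (∑ i : Fin 3, (a k i : ℝ) * y i)
    else 0

/-- `h = (2e)^{-10}`. -/
def hSmall : ℝ := 1 / (2 * Real.exp 1) ^ 10

/-- `Ω = {(w,y) : w ≥ w₂, |f₀(w,y)| < 2h}`, viewed as the (2π-periodic in `y`)
subset of `ℝ × ℝ³` corresponding to a subset of `ℝ × T³`. -/
def OmegaSet (ζ : ℝ → ℝ) (a : ℕ → Fin 3 → ℤ) : Set (ℝ × (Fin 3 → ℝ)) :=
  {p | wseq 2 ≤ p.1 ∧ |f0 ζ a p.1 p.2| < 2 * hSmall}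

end

noncomputable section
open Real MeasureTheory

/-- The flat (quotient) distance on the torus `T³ = ℝ³/(2πℤ)³`, computed on representatives. -/
def torusDist (y z : Fin 3 → ℝ) : ℝ :=
  ⨅ m : Fin 3 → ℤ, Real.sqrt (∑ i : Fin 3, (y i - z i - 2 * π * (m i)) ^ 2)

/-- The product flat distance on `ℝ × T³`, computed on representatives. -/
def cylDist (p q : ℝ × (Fin 3 → ℝ)) : ℝ :=
  Real.sqrt ((p.1 - q.1) ^ 2 + (torusDist p.2 q.2) ^ 2)


lemma abs_sub_le_of_abs_cos_sub_cos_lt {x y η : ℝ} (hx : x ∈ Set.Icc 0 π) (hy : y ∈ Set.Icc 0 π)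
    (hη : 0 < η) (hη' : η ≤ 1 / 4) (h : |cos x - cos y| < 8 * η ^ 2) : |x - y| ≤ 5 * η := by
  wlog hxy : x ≤ y generalizing x y
  · rw [abs_sub_comm]
    exact this hy hx (by rwa [abs_sub_comm]) (le_of_not_ge hxy)
  obtain ⟨hx0, hx1⟩ := hx
  obtain ⟨hy0, hy1⟩ := hy
  rw [abs_sub_comm, abs_of_nonneg (by linarith)]
  by_contra! hcon
  set d := (y - x) / 2 with hd
  have h1 : cos x - cos y = 2 * sin ((x + y) / 2) * sin d := by
    rw [cos_sub_cos, show (x - y) / 2 = -d by ring, sin_neg]; ring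
  have h2 : sin d ≤ sin ((x + y) / 2) := by
    have h3 : sin ((x + y) / 2) - sin d = 2 * sin (x / 2) * cos (y / 2) := by
      rw [sin_sub_sin, hd]; congr 2 <;> ring_nf
    have h4 : 0 ≤ sin (x / 2) := sin_nonneg_of_nonneg_of_le_pi (by linarith) (by linarith)
    have h5 : 0 ≤ cos (y / 2) := cos_nonneg_of_neg_pi_div_two_le_of_le (by linarith) (by linarith)
    nlinarith [mul_nonneg h4 h5]
  have h6 : sin (5 / 2 * η) ≤ sin d := sin_le_sin_of_le_of_le_pi_div_two (by linarith [pi_pos])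
    (by linarith) (by linarith)
  have h7 := sin_gt_sub_cube (x := 5 / 2 * η) (by positivity)
  have h8 : 2 * η < sin d := by
    nlinarith [mul_le_mul hη' hη' hη.le (by norm_num)]
  have h9 := (abs_lt.1 h).2
  rw [h1] at h9
  nlinarith

lemma volume_monotone_piece_le {κ A σ B η : ℝ} (hκ : 0 < κ) (hσ : 1 / 2 ≤ σ) (hη : 0 < η)
    (hη' : η ≤ 1 / 4) (n : ℤ) :
    volume {t : ℝ | κ * t + A ∈ Set.Icc (n * π) ((n + 1) * π) ∧
      |σ * cos (κ * t + A) + B| < 2 * η ^ 2} ≤ ENNReal.ofReal (5 * η / κ) := by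
  refine (Real.volume_le_diam _).trans (Metric.ediam_le ?_)
  rintro s ⟨⟨hs0, hs1⟩, hs⟩ t ⟨⟨ht0, ht1⟩, ht⟩
  rw [edist_dist, Real.dist_eq]
  refine ENNReal.ofReal_le_ofReal ?_
  have h1 : |cos (κ * s + A) - cos (κ * t + A)| < 8 * η ^ 2 := by
    rw [abs_lt] at hs ht ⊢
    constructor <;> nlinarith
  have h2 := abs_sub_le_of_abs_cos_sub_cos_lt (x := κ * s + A - n * π) (y := κ * t + A - n * π)
    ⟨by linarith, by linarith⟩ ⟨by linarith, by linarith⟩ hη hη' (by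
      rw [cos_sub_int_mul_pi, cos_sub_int_mul_pi, ← mul_sub, abs_mul]
      simpa using h1)
  rw [show κ * s + A - n * π - (κ * t + A - n * π) = κ * (s - t) by ring, abs_mul,
    abs_of_pos hκ] at h2
  rw [le_div_iff₀ hκ]; linarith

lemma volume_cos_sublevel_le {κ A σ B η R t₀ : ℝ} (hκ : 0 < κ) (hσ : 1 / 2 ≤ σ) (hη : 0 < η)
    (hη' : η ≤ 1 / 4) (hR : 2 * R * κ ≤ π) :
    volume {t : ℝ | |t - t₀| < R ∧ |σ * cos (κ * t + A) + B| < 2 * η ^ 2} ≤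
      ENNReal.ofReal (10 * η / κ) := by
  set p := κ * (t₀ - R) + A
  set n : ℤ := ⌊p / π⌋
  have hn0 : n * π ≤ p := (le_div_iff₀ pi_pos).1 (Int.floor_le _)
  have hn1 : p < (n + 1) * π := (div_lt_iff₀ pi_pos).1 (Int.lt_floor_add_one _)
  have hsub : {t : ℝ | |t - t₀| < R ∧ |σ * cos (κ * t + A) + B| < 2 * η ^ 2} ⊆
      {t : ℝ | κ * t + A ∈ Set.Icc (n * π) ((n + 1) * π) ∧
        |σ * cos (κ * t + A) + B| < 2 * η ^ 2} ∪
      {t : ℝ | κ * t + A ∈ Set.Icc (((n + 1 : ℤ) : ℝ) * π) (((n + 1 : ℤ) + 1) * π) ∧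
        |σ * cos (κ * t + A) + B| < 2 * η ^ 2} := by
    rintro t ⟨ht, hc⟩
    rw [abs_lt] at ht
    have h1 : p ≤ κ * t + A := by
      have := mul_le_mul_of_nonneg_left (show t₀ - R ≤ t by linarith) hκ.le
      simp only [p]; linarith
    have h2 : κ * t + A ≤ p + π := by
      have := mul_le_mul_of_nonneg_left (show t ≤ t₀ + R by linarith) hκ.le
      simp only [p]; linarith
    rcases le_total (κ * t + A) ((n + 1) * π) with h | h
    · exact Or.inl ⟨⟨by linarith, h⟩, hc⟩
    · refine Or.inr ⟨⟨by push_cast; exact h, ?_⟩, hc⟩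
      push_cast; linarith
  refine (measure_mono hsub).trans ((measure_union_le _ _).trans ?_)
  refine (add_le_add (volume_monotone_piece_le hκ hσ hη hη' n)
    (volume_monotone_piece_le hκ hσ hη hη' (n + 1))).trans ?_
  rw [← ENNReal.ofReal_add (by positivity) (by positivity)]
  refine ENNReal.ofReal_le_ofReal (le_of_eq (by ring))

lemma volume_box_cos_sublevel_le {α β z₀ : Fin 3 → ℝ} {σ τ η R : ℝ} (hα : 0 < α 0)
    (hβ : β 0 = 0) (hσ : 1 / 2 ≤ σ) (hη : 0 < η) (hη' : η ≤ 1 / 4) (hR : 2 * R * α 0 ≤ π) :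
    volume {z : Fin 3 → ℝ | (∀ i, |z i - z₀ i| < R) ∧
      |σ * cos (∑ i, α i * z i) + τ * cos (∑ i, β i * z i)| < 2 * η ^ 2} ≤
    ENNReal.ofReal (10 * η / α 0) * ENNReal.ofReal (2 * R) ^ 2 := by
  set T := {z : Fin 3 → ℝ | (∀ i, |z i - z₀ i| < R) ∧
      |σ * cos (∑ i, α i * z i) + τ * cos (∑ i, β i * z i)| < 2 * η ^ 2}
  have hT : MeasurableSet T := by
    have hTeq : T = (⋂ i, {z : Fin 3 → ℝ | |z i - z₀ i| < R}) ∩ {z : Fin 3 → ℝ |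
        |σ * cos (∑ i, α i * z i) + τ * cos (∑ i, β i * z i)| < 2 * η ^ 2} := by
      ext z; simp [T]
    rw [hTeq]
    refine (MeasurableSet.iInter fun i => ?_).inter ?_ <;>
    exact (isOpen_lt (by fun_prop) (by fun_prop)).measurableSet
  have hmp := (volume_preserving_piFinSuccAbove (fun _ : Fin 3 => ℝ) 0).symm
  rw [← hmp.measure_preimage hT.nullMeasurableSet]
  have hT' := hmp.measurable hT
  rw [Measure.volume_eq_prod, Measure.prod_apply_symm hT']
  set Q : Set (Fin 2 → ℝ) := Set.univ.pi fun j => Set.Ioo (z₀ j.succ - R) (z₀ j.succ + R)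
  have hQ : MeasurableSet Q := MeasurableSet.univ_pi fun _ => measurableSet_Ioo
  have hQvol : volume Q = ENNReal.ofReal (2 * R) ^ 2 := by
    simp only [Q, Real.volume_pi_Ioo]
    simp [two_mul, pow_two]
  have hval : ∀ (t : ℝ) (z : Fin 2 → ℝ),
      (MeasurableEquiv.piFinSuccAbove (fun _ : Fin 3 => ℝ) 0).symm (t, z) = Fin.cons t z := by
    intro t z
    simp only [MeasurableEquiv.piFinSuccAbove]
    simp; rfl
  calc _ ≤ ∫⁻ z, Q.indicator (fun _ => ENNReal.ofReal (10 * η / α 0)) z := by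
        refine lintegral_mono fun z => ?_
        by_cases hz : z ∈ Q
        · rw [Set.indicator_of_mem hz]
          refine le_trans (measure_mono ?_) (volume_cos_sublevel_le (t₀ := z₀ 0) (R := R)
            (A := ∑ j : Fin 2, α j.succ * z j) (B := τ * cos (∑ j : Fin 2, β j.succ * z j))
            hα hσ hη hη' hR)
          intro t ht
          simp only [Set.mem_preimage, hval] at ht
          obtain ⟨h1, h2⟩ := ht
          refine ⟨by simpa using h1 0, ?_⟩
          simpa [Fin.sum_univ_succ, hβ] using h2
        · rw [Set.indicator_of_notMem hz, nonpos_iff_eq_zero]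
          convert measure_empty (μ := (volume : Measure ℝ))
          ext t
          simp only [Set.mem_preimage, hval, Set.mem_empty_iff_false, iff_false]
          rintro ⟨h1, -⟩
          refine hz fun j _ => ?_
          have := h1 j.succ
          rw [Fin.cons_succ, abs_lt] at this
          constructor <;> linarith
    _ = _ := by rw [lintegral_indicator hQ, setLIntegral_const, hQvol]

lemma exists_unit_orthogonal {E : Type*} [NormedAddCommGroup E] [InnerProductSpace ℝ E] {a b : E}
    (ha : a ≠ 0) (hb : b ≠ 0) (hab : 3 * inner ℝ a b ^ 2 ≤ ‖a‖ ^ 2 * ‖b‖ ^ 2) :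
    ∃ u : E, ‖u‖ = 1 ∧ inner ℝ u b = 0 ∧ 0 < inner ℝ u a ∧
      2 / 3 * ‖a‖ ^ 2 ≤ inner ℝ u a ^ 2 := by
  have hb2 : 0 < ‖b‖ ^ 2 := by positivity
  have ha2 : 0 < ‖a‖ ^ 2 := by positivity
  set v := a - (inner ℝ a b / ‖b‖ ^ 2) • b with hv
  have hvb : inner ℝ v b = 0 := by
    rw [hv, inner_sub_left, inner_smul_left, real_inner_self_eq_norm_sq]
    simp [hb]
  have hva : inner ℝ v a = ‖v‖ ^ 2 := by
    rw [← real_inner_self_eq_norm_sq]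
    conv_rhs => rw [hv, inner_sub_right, inner_smul_right, ← hv, hvb]
    simp
  have hva' : inner ℝ v a = ‖a‖ ^ 2 - inner ℝ a b ^ 2 / ‖b‖ ^ 2 := by
    rw [hv, inner_sub_left, inner_smul_left, real_inner_self_eq_norm_sq, real_inner_comm]
    simp only [conj_trivial]
    rw [real_inner_comm a b]; ring
  have hge : 2 / 3 * ‖a‖ ^ 2 ≤ ‖v‖ ^ 2 := by
    rw [← hva, hva']
    have : inner ℝ a b ^ 2 / ‖b‖ ^ 2 ≤ 1 / 3 * ‖a‖ ^ 2 := by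
      rw [div_le_iff₀ hb2]; linarith
    linarith
  have hv0 : 0 < ‖v‖ := by
    rcases (norm_nonneg v).eq_or_lt with h | h
    · rw [← h] at hge; nlinarith
    · exact h
  have hua : inner ℝ (‖v‖⁻¹ • v) a = ‖v‖ := by
    rw [inner_smul_left, hva]
    simp only [conj_trivial]
    field_simp
  refine ⟨‖v‖⁻¹ • v, ?_, ?_, ?_, ?_⟩
  · rw [norm_smul, norm_inv, norm_norm, inv_mul_cancel₀ hv0.ne']
  · rw [inner_smul_left, hvb, mul_zero]
  · rwa [hua]
  · rwa [hua]

lemma volume_ball_cos_sublevel_le {a b y₀ : EuclideanSpace ℝ (Fin 3)} {σ τ η R κ : ℝ}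
    (ha : a ≠ 0) (hb : b ≠ 0) (hab : 3 * inner ℝ a b ^ 2 ≤ ‖a‖ ^ 2 * ‖b‖ ^ 2) (hκ : 0 < κ)
    (hκa : κ ^ 2 ≤ 2 / 3 * ‖a‖ ^ 2) (hσ : 1 / 2 ≤ σ) (hη : 0 < η) (hη' : η ≤ 1 / 4)
    (hR0 : 0 ≤ R) (hR : 2 * R * ‖a‖ ≤ π) :
    volume {y : EuclideanSpace ℝ (Fin 3) | ‖y - y₀‖ < R ∧
      |σ * cos (inner ℝ a y) + τ * cos (inner ℝ b y)| < 2 * η ^ 2} ≤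
    ENNReal.ofReal (10 * η / κ) * ENNReal.ofReal (2 * R) ^ 2 := by
  obtain ⟨u, hu, hub, hua, hua2⟩ := exists_unit_orthogonal ha hb hab
  obtain ⟨e, he⟩ := Orthonormal.exists_orthonormalBasis_extension_of_card_eq (𝕜 := ℝ)
    (E := EuclideanSpace ℝ (Fin 3)) (ι := Fin 3) (by simp) (v := fun _ => u) (s := {0})
    (by
      refine ⟨fun i => hu, fun i j hij => (hij (Subsingleton.elim i j)).elim⟩)
  have he0 : e 0 = u := he 0 rfl
  have hmp := e.measurePreserving_repr_symm.comp (PiLp.volume_preserving_toLp (Fin 3))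
  set T := {y : EuclideanSpace ℝ (Fin 3) | ‖y - y₀‖ < R ∧
      |σ * cos (inner ℝ a y) + τ * cos (inner ℝ b y)| < 2 * η ^ 2}
  have hT : MeasurableSet T := by
    have hTeq : T = {y | ‖y - y₀‖ < R} ∩
        {y | |σ * cos (inner ℝ a y) + τ * cos (inner ℝ b y)| < 2 * η ^ 2} := rfl
    rw [hTeq]
    refine MeasurableSet.inter ?_ ?_ <;>
    exact (isOpen_lt (by fun_prop) (by fun_prop)).measurableSet
  rw [← hmp.measure_preimage hT.nullMeasurableSet]
  have hinner : ∀ (c : EuclideanSpace ℝ (Fin 3)) (z : Fin 3 → ℝ),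
      inner ℝ c (e.repr.symm (WithLp.toLp 2 z)) = ∑ i, e.repr c i * z i := by
    intro c z
    rw [← e.repr.inner_map_map, LinearIsometryEquiv.apply_symm_apply, PiLp.inner_apply]
    simp [mul_comm]
  have hra : e.repr a 0 = inner ℝ u a := by rw [e.repr_apply_apply, he0]
  have hrb : e.repr b 0 = 0 := by rw [e.repr_apply_apply, he0, hub]
  have hκu : κ ≤ inner ℝ u a := by
    refine le_of_sq_le_sq ?_ hua.le
    linarith
  have hule : inner ℝ u a ≤ ‖a‖ := by
    have := real_inner_le_norm u a
    rwa [hu, one_mul] at this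
  have key := volume_box_cos_sublevel_le (α := e.repr a) (β := e.repr b) (z₀ := e.repr y₀)
    (σ := σ) (τ := τ) (η := η) (R := R) (by rw [hra]; exact hua) hrb hσ hη hη' (by
      rw [hra]
      exact (mul_le_mul_of_nonneg_left hule (by positivity)).trans hR)
  refine (measure_mono ?_).trans (key.trans ?_)
  · rintro z ⟨h1, h2⟩
    refine ⟨fun i => ?_, ?_⟩
    · refine lt_of_le_of_lt ?_ h1
      rw [← e.repr.norm_map, map_sub]
      simp only [Function.comp_apply, LinearIsometryEquiv.apply_symm_apply]
      exact PiLp.norm_apply_le (WithLp.toLp 2 z - e.repr y₀) i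
    · simpa only [Function.comp_apply, hinner] using h2
  · rw [hra]
    gcongr

lemma wseq_eq (k : ℕ) : wseq k = 27 / 8 * √(k : ℝ) ^ 3 := by
  rw [wseq, Real.sqrt_eq_rpow, ← Real.rpow_natCast, ← Real.rpow_mul (by positivity)]
  norm_num

lemma wseq_add_one_le (k : ℕ) : wseq k + 1 ≤ wseq (k + 1) := by
  rw [wseq_eq, wseq_eq]
  have hp : √((k + 1 : ℕ) : ℝ) ^ 2 = k + 1 := by rw [Real.sq_sqrt (by positivity)]; push_cast; ring
  have hq : √(k : ℝ) ^ 2 = k := Real.sq_sqrt (by positivity)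
  have hp1 : 1 ≤ √((k + 1 : ℕ) : ℝ) := by rw [Real.one_le_sqrt]; simp
  have hq0 : 0 ≤ √(k : ℝ) := Real.sqrt_nonneg _
  set p := √((k + 1 : ℕ) : ℝ)
  set q := √(k : ℝ)
  have h1 : (p - q) * (p + q) = 1 := by linear_combination hp - hq
  have h2 : 0 < p - q := by nlinarith
  have h3 : p + q ≤ p ^ 2 + p * q + q ^ 2 := by nlinarith
  have h4 := mul_le_mul_of_nonneg_left h3 h2.le
  nlinarith

lemma wseq_strictMono : StrictMono wseq :=
  strictMono_nat_of_lt_succ fun k => by linarith [wseq_add_one_le k]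

lemma natCast_le_wseq (k : ℕ) : (k : ℝ) ≤ wseq k := by
  induction k with
  | zero => simp [wseq_eq]
  | succ k ih => push_cast; linarith [wseq_add_one_le k]

lemma exists_wseq_le_lt {w : ℝ} (hw : wseq 2 ≤ w) :
    ∃ k : ℕ, 2 ≤ k ∧ wseq k ≤ w ∧ w < wseq (k + 1) := by
  classical
  have hex : ∃ n, w < wseq n := by
    obtain ⟨n, hn⟩ := exists_nat_gt w
    exact ⟨n, hn.trans_le (natCast_le_wseq n)⟩
  have hlt := Nat.find_spec hex
  have h2 : 2 < Nat.find hex := wseq_strictMono.lt_iff_lt.1 (hw.trans_lt hlt)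
  obtain ⟨k, hk⟩ : ∃ k, Nat.find hex = k + 1 := ⟨Nat.find hex - 1, by omega⟩
  refine ⟨k, by omega, ?_, hk ▸ hlt⟩
  exact not_lt.1 (Nat.find_min hex (by omega))

lemma zeta_div_eq_zero {ζ : ℝ → ℝ} (hζ : IsCutoff ζ) {x y : ℝ} (hx : x ≤ 0) (hy : 0 ≤ y) :
    ζ (x / y) = 0 :=
  hζ.2.1 _ (div_nonpos_of_nonpos_of_nonneg hx hy)

lemma zeta_div_eq_one {ζ : ℝ → ℝ} (hζ : IsCutoff ζ) {x y : ℝ} (hy : 0 < y) (hx : y ≤ x) :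
    ζ (x / y) = 1 :=
  hζ.2.2.1 _ ((one_le_div hy).2 hx)

lemma f0_eq {ζ : ℝ → ℝ} (hζ : IsCutoff ζ) (a : ℕ → Fin 3 → ℤ) {k : ℕ} (hk : 2 ≤ k) {w : ℝ}
    (h1 : wseq k ≤ w) (h2 : w ≤ wseq (k + 1)) (y : Fin 3 → ℝ) :
    f0 ζ a w y =
      (1 - ζ ((w - wseq k) / (wseq (k + 1) - wseq k))) * cos (∑ i, (a k i : ℝ) * y i) +
      ζ ((w - wseq k) / (wseq (k + 1) - wseq k)) * cos (∑ i, (a (k + 1) i : ℝ) * y i) := by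
  have hk0 := wseq_strictMono (show k - 1 < k by omega)
  have hk1 := wseq_strictMono (show k < k + 1 by omega)
  have hk2 := wseq_strictMono (show k + 1 < k + 1 + 1 by omega)
  rw [f0, tsum_eq_sum (s := {k, k + 1})]
  · rw [Finset.sum_pair (by omega), if_pos hk, if_pos (by omega), Nat.add_sub_cancel,
      zeta_div_eq_one hζ (x := w - wseq (k - 1)) (by linarith) (by linarith),
      zeta_div_eq_one hζ (x := wseq (k + 1 + 1) - w) (by linarith) (by linarith)]
    have h3 := hζ.2.2.2.2.2 ((w - wseq k) / (wseq (k + 1) - wseq k))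
    have h4 : (wseq (k + 1) - w) / (wseq (k + 1) - wseq k) =
        1 - (w - wseq k) / (wseq (k + 1) - wseq k) := by
      have : wseq (k + 1) - wseq k ≠ 0 := by linarith
      field_simp
      ring
    rw [h4, eq_sub_of_add_eq' h3]
    ring
  · intro j hj
    simp only [Finset.mem_insert, Finset.mem_singleton, not_or] at hj
    split_ifs with hj2
    · have hj0 := wseq_strictMono (show j - 1 < j by omega)
      have hj1 := wseq_strictMono (show j < j + 1 by omega)
      rcases lt_or_gt_of_ne hj.1 with h | h
      · have := wseq_strictMono.monotone (show j + 1 ≤ k by omega)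
        rw [zeta_div_eq_zero hζ (x := wseq (j + 1) - w) (by linarith) (by linarith)]
        ring
      · have := wseq_strictMono.monotone (show k + 1 ≤ j - 1 by omega)
        rw [zeta_div_eq_zero hζ (x := w - wseq (j - 1)) (by linarith) (by linarith)]
        ring
    · rfl

lemma measurable_f0 {ζ : ℝ → ℝ} (hζ : IsCutoff ζ) (a : ℕ → Fin 3 → ℤ) :
    Measurable fun p : ℝ × (Fin 3 → ℝ) => f0 ζ a p.1 p.2 := by
  have hm : Measurable ζ := hζ.1.continuous.measurable
  refine measurable_of_tendsto_metrizable (f := fun n (p : ℝ × (Fin 3 → ℝ)) =>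
    ∑ k ∈ Finset.range n, if 2 ≤ k then
      ζ ((p.1 - wseq (k - 1)) / (wseq k - wseq (k - 1))) *
        ζ ((wseq (k + 1) - p.1) / (wseq (k + 1) - wseq k)) *
        Real.cos (∑ i : Fin 3, (a k i : ℝ) * p.2 i)
    else 0) ?_ ?_
  · intro n
    refine Finset.measurable_sum _ fun k _ => ?_
    split_ifs
    · fun_prop
    · fun_prop
  · rw [tendsto_pi_nhds]
    rintro ⟨w, y⟩
    refine Summable.tendsto_sum_tsum_nat ?_
    obtain ⟨N, hN⟩ := exists_nat_gt w
    refine summable_of_ne_finset_zero (s := Finset.range (N + 1)) fun j hj => ?_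
    rw [Finset.mem_range, not_lt] at hj
    have h1 := wseq_strictMono.monotone (show N ≤ j - 1 by omega)
    have h2 := wseq_strictMono (show j - 1 < j by omega)
    have h3 := natCast_le_wseq N
    dsimp only
    rw [zeta_div_eq_zero hζ (x := w - wseq (j - 1)) (by linarith) (by linarith)]
    simp

lemma f0_sub_two_pi_mul (ζ : ℝ → ℝ) (a : ℕ → Fin 3 → ℤ) (w : ℝ) (y : Fin 3 → ℝ)
    (m : Fin 3 → ℤ) : f0 ζ a w (y - fun i => 2 * π * m i) = f0 ζ a w y := by
  unfold f0
  congr 1; ext k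
  have h : ∑ i, (a k i : ℝ) * (y - fun i => 2 * π * (m i : ℝ)) i =
      ∑ i, (a k i : ℝ) * y i - ((∑ i, a k i * m i : ℤ) : ℝ) * (2 * π) := by
    push_cast
    rw [Finset.sum_mul, ← Finset.sum_sub_distrib]
    exact Finset.sum_congr rfl fun i _ => by simp only [Pi.sub_apply]; ring
  rw [h, cos_sub_int_mul_two_pi]

lemma volume_le_of_torus {P Q : Set (ℝ × (Fin 3 → ℝ))} (hQ : MeasurableSet Q)
    (hP : ∀ p ∈ P, (∀ i, p.2 i ∈ Set.Ico (-π) π) ∧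
      ∃ m : Fin 3 → ℤ, (p.1, p.2 - fun i => 2 * π * (m i : ℝ)) ∈ Q) :
    volume P ≤ volume Q := by
  set C : (Fin 3 → ℤ) → Set (ℝ × (Fin 3 → ℝ)) := fun m =>
    {p | ∀ i, p.2 i + 2 * π * m i ∈ Set.Ico (-π) π} with hC
  have hCm : ∀ m, MeasurableSet (C m) := by
    intro m
    have hCeq : C m = ⋂ i, (fun p : ℝ × (Fin 3 → ℝ) => p.2 i + 2 * π * m i) ⁻¹' Set.Ico (-π) π := by
      ext p; simp [C]
    rw [hCeq]
    refine MeasurableSet.iInter fun i => measurableSet_Ico.preimage ?_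
    fun_prop
  have hdisj : Pairwise (Function.onFun Disjoint fun m => Q ∩ C m) := by
    intro m n hmn
    refine Set.disjoint_left.2 ?_
    rintro p ⟨-, hm⟩ ⟨-, hn⟩
    refine hmn (funext fun i => ?_)
    obtain ⟨m0, m1⟩ := hm i
    obtain ⟨n0, n1⟩ := hn i
    have h1 : ((m i - n i : ℤ) : ℝ) < 1 := by
      push_cast; nlinarith [pi_pos]
    have h2 : ((n i - m i : ℤ) : ℝ) < 1 := by
      push_cast; nlinarith [pi_pos]
    have h3 : m i - n i < 1 := by exact_mod_cast h1
    have h4 : n i - m i < 1 := by exact_mod_cast h2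
    omega
  have hsub : P ⊆ ⋃ m : Fin 3 → ℤ,
      (fun p => p + ((0 : ℝ), -fun i => 2 * π * (m i : ℝ))) ⁻¹' (Q ∩ C m) := by
    intro p hp
    obtain ⟨hcube, m, hm⟩ := hP p hp
    refine Set.mem_iUnion.2 ⟨m, ?_, fun i => ?_⟩
    · have heq : p + ((0 : ℝ), -fun i => 2 * π * (m i : ℝ)) =
          (p.1, p.2 - fun i => 2 * π * (m i : ℝ)) := by
        ext <;> simp [sub_eq_add_neg]
      simpa only [Set.mem_preimage, heq] using hm
    · simpa using hcube i
  have : (volume : Measure (ℝ × (Fin 3 → ℝ))).IsAddRightInvariant :=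
    inferInstanceAs ((volume : Measure ℝ).prod
      (volume : Measure (Fin 3 → ℝ))).IsAddRightInvariant
  calc volume P ≤ ∑' m, volume
        ((fun p => p + ((0 : ℝ), -fun i => 2 * π * (m i : ℝ))) ⁻¹' (Q ∩ C m)) :=
        (measure_mono hsub).trans (measure_iUnion_le _)
    _ = ∑' m, volume (Q ∩ C m) := by
        congr 1; ext m
        exact measure_preimage_add_right _ _ _
    _ = volume (⋃ m, Q ∩ C m) := (measure_iUnion hdisj fun m => hQ.inter (hCm m)).symm
    _ ≤ volume Q := measure_mono (Set.iUnion_subset fun m => Set.inter_subset_left)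

lemma exists_two_pi_shift_of_cylDist_lt {p q : ℝ × (Fin 3 → ℝ)} {R : ℝ} (h : cylDist p q < R) :
    |p.1 - q.1| < R ∧ ∃ m : Fin 3 → ℤ, √(∑ i, (p.2 i - q.2 i - 2 * π * m i) ^ 2) < R := by
  have hR : 0 < R := lt_of_le_of_lt (Real.sqrt_nonneg _) h
  have h1 := (Real.sqrt_lt' hR).1 h
  refine ⟨abs_lt_of_sq_lt_sq (by nlinarith) hR.le, ?_⟩
  have h2 : torusDist p.2 q.2 < R :=
    lt_of_le_of_lt (le_abs_self _) (abs_lt_of_sq_lt_sq (by nlinarith) hR.le)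
  exact exists_lt_of_ciInf_lt h2

lemma norm_toLp_intCast_sq (c : Fin 3 → ℤ) :
    ‖WithLp.toLp 2 fun i => (c i : ℝ)‖ ^ 2 = ((∑ i, c i ^ 2 : ℤ) : ℝ) := by
  rw [EuclideanSpace.real_norm_sq_eq]
  push_cast
  rfl

lemma three_mul_inner_sq_le {a : ℕ → Fin 3 → ℤ} (ha : IsGoodSeq a) {k : ℕ} (hk : 1 ≤ k) :
    3 * (inner ℝ (WithLp.toLp 2 fun i => (a k i : ℝ)) (WithLp.toLp 2 fun i => (a (k + 1) i : ℝ)) :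
      ℝ) ^ 2 ≤ ‖WithLp.toLp 2 fun i => (a k i : ℝ)‖ ^ 2 *
        ‖WithLp.toLp 2 fun i => (a (k + 1) i : ℝ)‖ ^ 2 := by
  have h := (ha k hk).2
  have hin : (inner ℝ (WithLp.toLp 2 fun i => (a k i : ℝ))
      (WithLp.toLp 2 fun i => (a (k + 1) i : ℝ)) : ℝ) = ∑ i, (a k i : ℝ) * a (k + 1) i := by
    rw [PiLp.inner_apply]
    simp [mul_comm]
  rw [EuclideanSpace.real_norm_sq_eq, EuclideanSpace.real_norm_sq_eq, hin]
  have h2 := pow_le_pow_left₀ (abs_nonneg _) h 2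
  rw [sq_abs, div_pow, mul_pow, Real.sq_sqrt (by positivity), Real.sq_sqrt (by positivity),
    Real.sq_sqrt (by norm_num), le_div_iff₀ (by norm_num)] at h2
  linarith

lemma volume_slice_le {ζ : ℝ → ℝ} (hζ : IsCutoff ζ) {a : ℕ → Fin 3 → ℤ} (ha : IsGoodSeq a)
    {k : ℕ} (hk : 2 ≤ k) {w η R κ : ℝ} (h1 : wseq k ≤ w) (h2 : w ≤ wseq (k + 1)) (hη : 0 < η)
    (hη' : η ≤ 1 / 4) (hR0 : 0 ≤ R) (hR : 4 * R ^ 2 * (4 * k + 5) ≤ 9) (hκ : 0 < κ)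
    (hκk : κ ^ 2 ≤ 2 / 3 * (4 * k + 1)) (y₀ : Fin 3 → ℝ) :
    volume {y : Fin 3 → ℝ | √(∑ i, (y i - y₀ i) ^ 2) < R ∧ |f0 ζ a w y| < 2 * η ^ 2} ≤
      ENNReal.ofReal (10 * η / κ) * ENNReal.ofReal (2 * R) ^ 2 := by
  set A : EuclideanSpace ℝ (Fin 3) := WithLp.toLp 2 fun i => (a k i : ℝ) with hA
  set B : EuclideanSpace ℝ (Fin 3) := WithLp.toLp 2 fun i => (a (k + 1) i : ℝ) with hB
  have hA2 : ‖A‖ ^ 2 = 4 * k + 1 := by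
    rw [hA, norm_toLp_intCast_sq, (ha k (by omega)).1]; push_cast; ring
  have hB2 : ‖B‖ ^ 2 = 4 * k + 5 := by
    rw [hB, norm_toLp_intCast_sq, (ha (k + 1) (by omega)).1]; push_cast; ring
  have hA0 : A ≠ 0 := by
    intro h; rw [h, norm_zero] at hA2
    have : (0 : ℝ) ≤ k := by positivity
    linarith
  have hB0 : B ≠ 0 := by
    intro h; rw [h, norm_zero] at hB2
    have : (0 : ℝ) ≤ k := by positivity
    linarith
  have hAB : 3 * (inner ℝ A B : ℝ) ^ 2 ≤ ‖A‖ ^ 2 * ‖B‖ ^ 2 := three_mul_inner_sq_le ha (by omega)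
  have hRle : ∀ c : ℝ, 0 ≤ c → c ^ 2 ≤ 4 * k + 5 → 2 * R * c ≤ π := by
    intro c hc hc2
    have h3 : (2 * R * c) ^ 2 ≤ 3 ^ 2 := by
      have := mul_le_mul_of_nonneg_left hc2 (show 0 ≤ 4 * R ^ 2 by positivity)
      nlinarith
    exact (le_of_sq_le_sq h3 (by norm_num)).trans pi_gt_three.le
  set s := ζ ((w - wseq k) / (wseq (k + 1) - wseq k)) with hs
  set S := {y : Fin 3 → ℝ | √(∑ i, (y i - y₀ i) ^ 2) < R ∧ |f0 ζ a w y| < 2 * η ^ 2}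
  set T := {y : EuclideanSpace ℝ (Fin 3) | ‖y - WithLp.toLp 2 y₀‖ < R ∧
      |(1 - s) * cos (inner ℝ A y) + s * cos (inner ℝ B y)| < 2 * η ^ 2} with hTdef
  have hT : MeasurableSet T := by
    have hTeq : T = {y | ‖y - WithLp.toLp 2 y₀‖ < R} ∩
        {y | |(1 - s) * cos (inner ℝ A y) + s * cos (inner ℝ B y)| < 2 * η ^ 2} := rfl
    rw [hTeq]
    refine MeasurableSet.inter ?_ ?_ <;>
    exact (isOpen_lt (by fun_prop) (by fun_prop)).measurableSet
  have hST : S = WithLp.toLp 2 ⁻¹' T := by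
    ext y
    simp only [S, T, Set.mem_ofPred_eq, Set.mem_preimage]
    rw [f0_eq hζ a hk h1 h2, EuclideanSpace.norm_eq, PiLp.inner_apply, PiLp.inner_apply]
    simp [A, B, s, mul_comm]
  rw [hST, (PiLp.volume_preserving_toLp (Fin 3)).measure_preimage hT.nullMeasurableSet]
  rcases le_total s (1 / 2) with h | h
  · exact volume_ball_cos_sublevel_le hA0 hB0 hAB hκ (by rw [hA2]; exact hκk) (by linarith) hη hη'
      hR0 (hRle _ (norm_nonneg _) (by linarith))
  · have hTeq : T = {y : EuclideanSpace ℝ (Fin 3) | ‖y - WithLp.toLp 2 y₀‖ < R ∧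
        |s * cos (inner ℝ B y) + (1 - s) * cos (inner ℝ A y)| < 2 * η ^ 2} := by
      simp only [hTdef, add_comm]
    rw [hTeq]
    exact volume_ball_cos_sublevel_le hB0 hA0 (by rw [real_inner_comm, mul_comm (‖B‖ ^ 2)]; exact hAB)
      hκ (by rw [hB2]; linarith) h hη hη' hR0 (hRle _ (norm_nonneg _) hB2.le)

lemma sqrt_hSmall_sq : √hSmall ^ 2 = hSmall :=
  Real.sq_sqrt (by unfold hSmall; positivity)

lemma sqrt_hSmall_pos : 0 < √hSmall := Real.sqrt_pos.2 (by unfold hSmall; positivity)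

lemma sqrt_hSmall_le : √hSmall ≤ 1 / 4 := by
  rw [Real.sqrt_le_left (by norm_num), hSmall]
  have h2 : (2 : ℝ) ≤ 2 * exp 1 := by linarith [Real.add_one_le_exp (1 : ℝ)]
  have h3 : (2 : ℝ) ^ 10 ≤ (2 * exp 1) ^ 10 := pow_le_pow_left₀ (by norm_num) h2 10
  rw [div_le_iff₀ (by positivity)]
  linarith

lemma radius_bounds {w x : ℝ} (hx : wseq 3 ≤ x)
    (hwx : |w - x| < 3 / (4 * x ^ ((1 : ℝ) / 3))) :
    ∃ k : ℕ, 2 ≤ k ∧ wseq k ≤ w ∧ w ≤ wseq (k + 1) ∧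
      4 * (3 / (4 * x ^ ((1 : ℝ) / 3))) ^ 2 * (4 * k + 5) ≤ 9 ∧
      9 ≤ 25 * (3 / (4 * x ^ ((1 : ℝ) / 3))) ^ 2 * (2 / 3 * (4 * k + 1)) := by
  have hx0 : 0 < x := by linarith [natCast_le_wseq 3, show (0 : ℝ) < (3 : ℕ) by norm_num]
  have hvpos : 0 < 2 / 3 * x ^ ((1 : ℝ) / 3) := by positivity
  set v := 2 / 3 * x ^ ((1 : ℝ) / 3) with hv
  have hR : 3 / (4 * x ^ ((1 : ℝ) / 3)) = 1 / (2 * v) := by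
    rw [hv]; field_simp; norm_num
  have hxv : x = 27 / 8 * v ^ 3 := by
    have : (x ^ ((1 : ℝ) / 3)) ^ 3 = x := by
      rw [← Real.rpow_natCast, ← Real.rpow_mul hx0.le]; norm_num
    rw [hv, mul_pow, this]; ring
  have hlow : ∀ j : ℕ, wseq j ≤ x → (j : ℝ) ≤ v ^ 2 := by
    intro j hj
    rw [wseq_eq, hxv] at hj
    have h3 : √(j : ℝ) ≤ v := le_of_pow_le_pow_left₀ (n := 3) (by norm_num) hvpos.le (by linarith)
    calc (j : ℝ) = √(j : ℝ) ^ 2 := (Real.sq_sqrt (by positivity)).symm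
      _ ≤ v ^ 2 := pow_le_pow_left₀ (Real.sqrt_nonneg _) h3 2
  have hupp : ∀ j : ℕ, x ≤ wseq j → v ^ 2 ≤ j := by
    intro j hj
    rw [wseq_eq, hxv] at hj
    have h3 : v ≤ √(j : ℝ) :=
      le_of_pow_le_pow_left₀ (n := 3) (by norm_num) (Real.sqrt_nonneg _) (by linarith)
    calc v ^ 2 ≤ √(j : ℝ) ^ 2 := pow_le_pow_left₀ hvpos.le h3 2
      _ = j := Real.sq_sqrt (by positivity)
  have hv3 : 3 ≤ v ^ 2 := by exact_mod_cast hlow 3 hx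
  have hv1 : 1 ≤ v := by nlinarith
  rw [hR] at hwx ⊢
  have hR1 : 1 / (2 * v) ≤ 1 := by rw [div_le_one (by positivity)]; linarith
  obtain ⟨hw1, hw2⟩ := abs_lt.1 (hwx.trans_le hR1)
  obtain ⟨k, hk, hk1, hk2⟩ := exists_wseq_le_lt (w := w) (by linarith [wseq_add_one_le 2])
  have hvk : v ^ 2 ≤ k + 2 := by
    have := hupp (k + 2) (by linarith [wseq_add_one_le (k + 1)])
    exact_mod_cast this
  have hkv : (k : ℝ) ≤ v ^ 2 + 1 := by
    obtain ⟨j, rfl⟩ : ∃ j, k = j + 1 := ⟨k - 1, by omega⟩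
    have := hlow j (by linarith [wseq_add_one_le j])
    push_cast; linarith
  have hk' : (2 : ℝ) ≤ k := by exact_mod_cast hk
  have hsq : (1 / (2 * v)) ^ 2 = 1 / (4 * v ^ 2) := by rw [div_pow, mul_pow]; norm_num
  refine ⟨k, hk, hk1, hk2.le, ?_, ?_⟩
  · rw [hsq, show 4 * (1 / (4 * v ^ 2)) * (4 * (k : ℝ) + 5) = (4 * k + 5) / v ^ 2 by field_simp,
      div_le_iff₀ (by positivity)]
    linarith
  · rw [hsq, show 25 * (1 / (4 * v ^ 2)) * (2 / 3 * (4 * (k : ℝ) + 1)) =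
      25 * (4 * k + 1) / (6 * v ^ 2) by field_simp; ring, le_div_iff₀ (by positivity)]
    linarith

/-- **Corollary 2.6.** Let `x* = (w*, y*) ∈ ℝ × T³` with `w* ≥ w₃` and `R* = 3/(4w*^{1/3})`.
Then `mes₄(B_{R*}(x*) ∩ Ω) < 32√h · mes₄(B_{R*})`, where `mes₄(B_{R*}) = π²R*⁴/2`
(the measure on `ℝ × T³` computed on `ℝ × [-π,π)³`). -/
theorem statement11 (ζ : ℝ → ℝ) (hζ : IsCutoff ζ) (a : ℕ → Fin 3 → ℤ) (ha : IsGoodSeq a)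
    (xstar : ℝ × (Fin 3 → ℝ)) (hw : wseq 3 ≤ xstar.1) :
    volume {p : ℝ × (Fin 3 → ℝ) | (∀ i, p.2 i ∈ Set.Ico (-π) π) ∧
        cylDist p xstar < 3 / (4 * xstar.1 ^ ((1 : ℝ) / 3)) ∧ p ∈ OmegaSet ζ a} <
      ENNReal.ofReal (32 * Real.sqrt hSmall *
        (π ^ 2 * (3 / (4 * xstar.1 ^ ((1 : ℝ) / 3))) ^ 4 / 2)) := by
  obtain ⟨x, y₀⟩ := xstar
  dsimp only at hw ⊢
  have hx0 : 0 < x := by linarith [natCast_le_wseq 3, show (0 : ℝ) < (3 : ℕ) by norm_num]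
  have hRpos : 0 < 3 / (4 * x ^ ((1 : ℝ) / 3)) := by positivity
  have hbounds := fun w => radius_bounds (w := w) hw
  set R := 3 / (4 * x ^ ((1 : ℝ) / 3))
  set η := √hSmall
  have hη : 0 < η := sqrt_hSmall_pos
  have hη2 : η ^ 2 = hSmall := sqrt_hSmall_sq
  set Q : Set (ℝ × (Fin 3 → ℝ)) := {p | |p.1 - x| < R} ∩
    ({p | √(∑ i, (p.2 i - y₀ i) ^ 2) < R} ∩ {p | |f0 ζ a p.1 p.2| < 2 * η ^ 2})
  have hf := measurable_f0 hζ a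
  have hQ : MeasurableSet Q := by
    refine MeasurableSet.inter ?_ (MeasurableSet.inter ?_ ?_)
    · exact (isOpen_lt (by fun_prop) (by fun_prop)).measurableSet
    · exact (isOpen_lt (by fun_prop) (by fun_prop)).measurableSet
    · exact measurableSet_lt (continuous_abs.measurable.comp hf) measurable_const
  set V := ENNReal.ofReal (10 * η / (3 / (5 * R))) * ENNReal.ofReal (2 * R) ^ 2 with hV
  have hslice : ∀ w ∈ Set.Ioo (x - R) (x + R), volume (Prod.mk w ⁻¹' Q) ≤ V := by
    intro w hwI
    obtain ⟨k, hk, h1, h2, h3, h4⟩ :=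
      hbounds w (abs_lt.2 ⟨by linarith [hwI.1], by linarith [hwI.2]⟩)
    refine le_trans (measure_mono ?_) (volume_slice_le hζ ha hk h1 h2 hη sqrt_hSmall_le hRpos.le h3
      (κ := 3 / (5 * R)) (by positivity) ?_ y₀)
    · exact fun y hy => hy.2
    · rw [div_pow, div_le_iff₀ (by positivity)]
      linarith
  have hQvol : volume Q ≤ V * ENNReal.ofReal (2 * R) := by
    rw [Measure.volume_eq_prod, Measure.prod_apply hQ]
    calc _ ≤ ∫⁻ w, (Set.Ioo (x - R) (x + R)).indicator (fun _ => V) w := by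
          refine lintegral_mono fun w => ?_
          by_cases hwI : w ∈ Set.Ioo (x - R) (x + R)
          · rw [Set.indicator_of_mem hwI]
            exact hslice w hwI
          · rw [Set.indicator_of_notMem hwI, nonpos_iff_eq_zero]
            convert measure_empty (μ := (volume : Measure (Fin 3 → ℝ)))
            ext y
            simp only [Set.mem_preimage, Set.mem_empty_iff_false, iff_false]
            rintro ⟨h1, -⟩
            obtain ⟨h2, h3⟩ := abs_lt.1 (show |w - x| < R from h1)
            exact hwI ⟨by linarith, by linarith⟩
      _ = _ := by
          rw [lintegral_indicator measurableSet_Ioo, setLIntegral_const, Real.volume_Ioo]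
          ring_nf
  refine lt_of_le_of_lt ((volume_le_of_torus hQ ?_).trans hQvol) ?_
  · rintro p ⟨hcube, hdist, -, hsmall⟩
    obtain ⟨h1, m, hm⟩ := exists_two_pi_shift_of_cylDist_lt hdist
    refine ⟨hcube, m, h1, ?_, ?_⟩
    · simpa only [Set.mem_ofPred_eq, Pi.sub_apply, sub_right_comm] using hm
    · simp only [Set.mem_ofPred_eq]
      rwa [f0_sub_two_pi_mul, hη2]
  · rw [hV, ← ENNReal.ofReal_pow (by positivity), ← ENNReal.ofReal_mul (by positivity),
      ← ENNReal.ofReal_mul (by positivity), ENNReal.ofReal_lt_ofReal_iff (by positivity),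
      show 10 * η / (3 / (5 * R)) * (2 * R) ^ 2 * (2 * R) = 400 / 3 * (η * R ^ 4) by
        field_simp; ring]
    have hpi : 9 < π ^ 2 := by nlinarith [pi_gt_three]
    have hpos : 0 < η * R ^ 4 := by positivity
    nlinarith

end
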